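/- arXiv:1607.04061 — 7 statements merged into one kernel-verified Lean document; each statement's English description precedes it below -/
import Mathlib

section
/- Let p, q be unit quaternions and let Z = (U,V), Z' = (U',V') be tangent vectors to S³×S³ at (p,q). Then g(PZ, PZ') = g(Z, Z'); that is, the almost product structure P of the homogeneous nearly Kähler S³×S³ is compatible with the metric g. -/
open Quaternion
open scoped RealInnerProductSpace

/-- The Hermitian metric `g` of the homogeneous nearly Kähler `S³×S³` at `(p,q)`. -/
noncomputable def gNK (p q : ℍ[ℝ]) (Z Zp : ℍ[ℝ] × ℍ[ℝ]) : ℝ :=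
  (4/3) * (⟪Z.1, Zp.1⟫ + ⟪Z.2, Zp.2⟫)
    - (2/3) * (⟪p⁻¹ * Z.1, q⁻¹ * Zp.2⟫ + ⟪p⁻¹ * Zp.1, q⁻¹ * Z.2⟫)

/-- The almost product structure `P` of the homogeneous nearly Kähler `S³×S³` at `(p,q)`:
`P(U,V) = (pq⁻¹V, qp⁻¹U)`. -/
noncomputable def Pmap (p q : ℍ[ℝ]) (Z : ℍ[ℝ] × ℍ[ℝ]) : ℍ[ℝ] × ℍ[ℝ] :=
  (p * q⁻¹ * Z.2, q * p⁻¹ * Z.1)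

/-- Left multiplication by a quaternion scales the inner product by its squared norm. -/
theorem Quaternion.inner_mul_left_mul_left (a x y : ℍ[ℝ]) :
    ⟪a * x, a * y⟫ = ‖a‖ ^ 2 * ⟪x, y⟫ := by
  rw [sq, ← Quaternion.normSq_eq_norm_mul_self, Quaternion.normSq_def']
  simp only [Quaternion.inner_def, Quaternion.re_mul, Quaternion.imI_mul, Quaternion.imJ_mul,
    Quaternion.imK_mul, Quaternion.re_star, Quaternion.imI_star, Quaternion.imJ_star,
    Quaternion.imK_star]
  ring

/-- The almost product structure `P` of the nearly Kähler `S³×S³` is compatible with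
the metric `g`: `g(PZ, PZ') = g(Z, Z')`. -/
theorem P_compatible (p q U V U' V' : ℍ[ℝ]) (hp : ‖p‖ = 1) (hq : ‖q‖ = 1)
    (hU : ⟪U, p⟫ = 0) (hV : ⟪V, q⟫ = 0) (hU' : ⟪U', p⟫ = 0) (hV' : ⟪V', q⟫ = 0) :
    gNK p q (Pmap p q (U, V)) (Pmap p q (U', V')) = gNK p q (U, V) (U', V') := by
  have hp0 : p ≠ 0 := norm_ne_zero_iff.mp (by simp [hp])
  have hq0 : q ≠ 0 := norm_ne_zero_iff.mp (by simp [hq])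
  have hp' : ‖p⁻¹‖ = 1 := by simp [hp]
  have hq' : ‖q⁻¹‖ = 1 := by simp [hq]
  simp only [gNK, Pmap, mul_assoc, inv_mul_cancel_left₀ hp0, inv_mul_cancel_left₀ hq0,
    Quaternion.inner_mul_left_mul_left p, Quaternion.inner_mul_left_mul_left q,
    Quaternion.inner_mul_left_mul_left p⁻¹, Quaternion.inner_mul_left_mul_left q⁻¹,
    hp, hq, hp', hq']
  rw [real_inner_comm (q⁻¹ * V), real_inner_comm (q⁻¹ * V')]
  ring
end

section
/- Let p, q be unit quaternions. For every pair (U,V) ∈ ℍ×ℍ one has P(J(U,V)) = −J(P(U,V)); that is, the almost product structure P of the homogeneous nearly Kähler S³×S³ anti-commutes with the almost complex structure J. -/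
open Quaternion
open scoped RealInnerProductSpace

/-- The almost complex structure `J` of the homogeneous nearly Kähler `S³×S³` at `(p,q)`:
`J(U,V) = (1/√3)(2pq⁻¹V − U, −2qp⁻¹U + V)`. -/
noncomputable def Jmap (p q : ℍ[ℝ]) (Z : ℍ[ℝ] × ℍ[ℝ]) : ℍ[ℝ] × ℍ[ℝ] :=
  ((Real.sqrt 3)⁻¹ • (2 * (p * q⁻¹ * Z.2) - Z.1),
   (Real.sqrt 3)⁻¹ • (-(2 * (q * p⁻¹ * Z.1)) + Z.2))

/-- The almost product structure `P` anti-commutes with the almost complex structure `J`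
of the homogeneous nearly Kähler `S³×S³`: `P ∘ J = −(J ∘ P)`. -/
theorem P_anticommutes_J (p q : ℍ[ℝ]) (hp : ‖p‖ = 1) (hq : ‖q‖ = 1) :
    ∀ U V : ℍ[ℝ], Pmap p q (Jmap p q (U, V)) = -(Jmap p q (Pmap p q (U, V))) := by
  intro U V
  have hp0 : p ≠ 0 := norm_ne_zero_iff.mp (by simp [hp])
  have hq0 : q ≠ 0 := norm_ne_zero_iff.mp (by simp [hq])
  have hpq (X : ℍ[ℝ]) : p * q⁻¹ * (q * p⁻¹ * X) = X := by
    simp [mul_assoc, hp0, hq0]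
  have hqp (X : ℍ[ℝ]) : q * p⁻¹ * (p * q⁻¹ * X) = X := by
    simp [mul_assoc, hp0, hq0]
  ext1
  · simp only [Pmap, Jmap, Prod.fst_neg, mul_smul_comm, ← smul_neg, mul_add, mul_neg, two_mul, hpq]
    congr 1
    abel
  · simp only [Pmap, Jmap, Prod.snd_neg, mul_smul_comm, ← smul_neg, mul_add, mul_sub, two_mul, hqp]
    congr 1
    abel
end

section
/- The totally geodesic immersion f₁ : S³ → S³×S³, u ↦ (1,u), is Lagrangian: for every unit quaternion u and all X, Y ∈ ℍ with ⟨X,u⟩ = ⟨Y,u⟩ = 0, the differentials df₁(X) = (0,X), df₁(Y) = (0,Y) are tangent to S³×S³ at (1,u) and satisfy g(J df₁(X), df₁(Y)) = 0 at the point (p,q) = (1,u). -/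
open Quaternion
open scoped RealInnerProductSpace

/-- The imaginary quaternion unit `𝐢`. -/
def qI : ℍ[ℝ] := ⟨0, 1, 0, 0⟩

/-- The imaginary quaternion unit `𝐣`. -/
def qJ : ℍ[ℝ] := ⟨0, 0, 1, 0⟩

/-- Left multiplication by the inverse of a unit quaternion is an isometry. -/
theorem inner_inv_mul_inv_mul {u : ℍ[ℝ]} (hu : ‖u‖ = 1) (X Y : ℍ[ℝ]) :
    ⟪u⁻¹ * X, u⁻¹ * Y⟫ = ⟪X, Y⟫ := by
  have hn : u.re ^ 2 + u.imI ^ 2 + u.imJ ^ 2 + u.imK ^ 2 = 1 := by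
    rw [← Quaternion.normSq_def', Quaternion.normSq_eq_norm_mul_self, hu, one_mul]
  have hinv : u⁻¹ = star u := by
    rw [Quaternion.inv_def, Quaternion.normSq_eq_norm_mul_self, hu, one_mul, inv_one, one_smul]
  rw [hinv]
  simp only [Quaternion.inner_def, Quaternion.re_mul, Quaternion.imI_mul, Quaternion.imJ_mul,
    Quaternion.imK_mul, Quaternion.re_star, Quaternion.imI_star, Quaternion.imJ_star,
    Quaternion.imK_star]
  linear_combination (X.re * Y.re + X.imI * Y.imI + X.imJ * Y.imJ + X.imK * Y.imK) * hn

/-- The totally geodesic immersion `f₁ : S³ → S³×S³`, `u ↦ (1,u)`, is Lagrangian: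
its differentials `(0,X)` are tangent to `S³×S³` at `(1,u)` and
`g(J df₁(X), df₁(Y)) = 0`. -/
theorem f1_lagrangian (u X Y : ℍ[ℝ]) (hu : ‖u‖ = 1)
    (hX : ⟪X, u⟫ = 0) (hY : ⟪Y, u⟫ = 0) :
    (⟪(0 : ℍ[ℝ]), (1 : ℍ[ℝ])⟫ = 0 ∧ ⟪X, u⟫ = 0 ∧ ⟪Y, u⟫ = 0) ∧
      gNK 1 u (Jmap 1 u ((0 : ℍ[ℝ]), X)) ((0 : ℍ[ℝ]), Y) = 0 := by
  refine ⟨⟨inner_zero_left _, hX, hY⟩, ?_⟩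
  simp only [gNK, Jmap, inv_one, one_mul, mul_one, mul_zero, sub_zero, neg_zero, zero_add,
    inner_zero_left, inner_zero_right, add_zero, two_mul, real_inner_smul_left,
    inner_add_left, inner_inv_mul_inv_mul hu]
  ring
end

section
/- The totally geodesic diagonal immersion f₃ : S³ → S³×S³, u ↦ (u,u), is Lagrangian: for every unit quaternion u and all X, Y ∈ ℍ with ⟨X,u⟩ = ⟨Y,u⟩ = 0, the differentials df₃(X) = (X,X), df₃(Y) = (Y,Y) are tangent to S³×S³ at (u,u) and satisfy g(J df₃(X), df₃(Y)) = 0 at the point (p,q) = (u,u). -/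
open Quaternion
open scoped RealInnerProductSpace

/-- The totally geodesic diagonal immersion `f₃ : S³ → S³×S³`, `u ↦ (u,u)`, is Lagrangian:
its differentials `(X,X)` are tangent to `S³×S³` at `(u,u)` and
`g(J df₃(X), df₃(Y)) = 0`. -/
theorem f3_lagrangian (u X Y : ℍ[ℝ]) (hu : ‖u‖ = 1)
    (hX : ⟪X, u⟫ = 0) (hY : ⟪Y, u⟫ = 0) :
    (⟪X, u⟫ = 0 ∧ ⟪Y, u⟫ = 0) ∧
      gNK u u (Jmap u u (X, X)) (Y, Y) = 0 := by
  refine ⟨⟨hX, hY⟩, ?_⟩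
  have hu0 : u ≠ 0 := norm_ne_zero_iff.mp (by simp [hu])
  have hJ : Jmap u u (X, X) = ((Real.sqrt 3)⁻¹ • X, -((Real.sqrt 3)⁻¹ • X)) := by
    simp only [Jmap, mul_inv_cancel₀ hu0, one_mul, two_mul, ← smul_neg]
    congr 2 <;> abel
  simp only [hJ, gNK, mul_neg, inner_neg_left, inner_neg_right]
  rw [real_inner_comm (u⁻¹ * Y)]
  ring
end

section
/- The totally geodesic immersion f₄ : S³ → S³×S³, u ↦ (u, u𝐢), where 𝐢 is the imaginary quaternion unit, is Lagrangian: for every unit quaternion u and all X, Y ∈ ℍ with ⟨X,u⟩ = ⟨Y,u⟩ = 0, the differentials df₄(X) = (X, X𝐢), df₄(Y) = (Y, Y𝐢) are tangent to S³×S³ at (u, u𝐢) and satisfy g(J df₄(X), df₄(Y)) = 0 at the point (p,q) = (u, u𝐢). -/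
open Quaternion
open scoped RealInnerProductSpace

theorem Quaternion.real_inner_mul_left (u x y : ℍ[ℝ]) :
    ⟪u * x, u * y⟫ = normSq u * ⟪x, y⟫ := by
  simp only [Quaternion.inner_def, normSq_def', re_mul, imI_mul, imJ_mul, imK_mul, re_star,
    imI_star, imJ_star, imK_star]
  ring

theorem Quaternion.real_inner_mul_right (u x y : ℍ[ℝ]) :
    ⟪x * u, y * u⟫ = normSq u * ⟪x, y⟫ := by
  simp only [Quaternion.inner_def, normSq_def', re_mul, imI_mul, imJ_mul, imK_mul, re_star,
    imI_star, imJ_star, imK_star]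
  ring

@[simp] theorem qI_re : qI.re = 0 := rfl

@[simp] theorem qI_imI : qI.imI = 1 := rfl

@[simp] theorem qI_imJ : qI.imJ = 0 := rfl

@[simp] theorem qI_imK : qI.imK = 0 := rfl

theorem qI_mul_qI : qI * qI = -1 := by
  ext <;> simp

theorem qI_inv : qI⁻¹ = -qI :=
  inv_eq_of_mul_eq_one_right (by rw [mul_neg, qI_mul_qI, neg_neg])

/-- The components of `J df₄(u a)` after left translation by `u`. -/
theorem Jmap_f4 {u : ℍ[ℝ]} (hu : u ≠ 0) (a : ℍ[ℝ]) :
    Jmap u (u * qI) (u * a, u * a * qI) =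
      (u * (Real.sqrt 3)⁻¹ • (-(2 : ℝ) • (qI * a * qI) - a),
       u * (Real.sqrt 3)⁻¹ • (-(2 : ℝ) • (qI * a) + a * qI)) := by
  have h (x : ℍ[ℝ]) : u⁻¹ * (u * x) = x := inv_mul_cancel_left₀ hu x
  ext1 <;>
    simp only [Jmap, mul_inv_rev, qI_inv, mul_assoc, h, mul_smul_comm, mul_sub, mul_add,
      neg_mul, mul_neg, neg_smul, two_smul, two_mul]

/-- The totally geodesic immersion `f₄ : S³ → S³×S³`, `u ↦ (u, u𝐢)`, is Lagrangian:
its differentials `(X, X𝐢)` are tangent to `S³×S³` at `(u, u𝐢)` and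
`g(J df₄(X), df₄(Y)) = 0`. -/
theorem f4_lagrangian (u X Y : ℍ[ℝ]) (hu : ‖u‖ = 1)
    (hX : ⟪X, u⟫ = 0) (hY : ⟪Y, u⟫ = 0) :
    (⟪X, u⟫ = 0 ∧ ⟪X * qI, u * qI⟫ = 0 ∧ ⟪Y, u⟫ = 0 ∧ ⟪Y * qI, u * qI⟫ = 0) ∧
      gNK u (u * qI) (Jmap u (u * qI) (X, X * qI)) (Y, Y * qI) = 0 := by
  have hu0 : u ≠ 0 := norm_ne_zero_iff.mp (by rw [hu]; exact one_ne_zero)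
  have hn : normSq u = 1 := by rw [normSq_eq_norm_mul_self, hu, mul_one]
  have tangent (Z : ℍ[ℝ]) (hZ : ⟪Z, u⟫ = 0) : ⟪Z * qI, u * qI⟫ = 0 := by
    rw [Quaternion.real_inner_mul_right, hZ, mul_zero]
  refine ⟨⟨hX, tangent X hX, hY, tangent Y hY⟩, ?_⟩
  obtain ⟨a, rfl⟩ : ∃ a, X = u * a := ⟨u⁻¹ * X, (mul_inv_cancel_left₀ hu0 X).symm⟩
  obtain ⟨b, rfl⟩ : ∃ b, Y = u * b := ⟨u⁻¹ * Y, (mul_inv_cancel_left₀ hu0 Y).symm⟩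
  have h (x : ℍ[ℝ]) : u⁻¹ * (u * x) = x := inv_mul_cancel_left₀ hu0 x
  rw [Jmap_f4 hu0]
  simp only [gNK, mul_inv_rev, qI_inv, mul_assoc, h, Quaternion.real_inner_mul_left, hn, one_mul]
  simp [Quaternion.inner_def]
  ring
end

section
/- The totally geodesic immersion f₅ : S³ → S³×S³, u ↦ (u𝐢u⁻¹, u⁻¹), where 𝐢 is the imaginary quaternion unit, is Lagrangian: for every unit quaternion u and all X, Y ∈ ℍ with ⟨X,u⟩ = ⟨Y,u⟩ = 0, the differentials df₅(X) = (X𝐢u⁻¹ − u𝐢u⁻¹Xu⁻¹, −u⁻¹Xu⁻¹), df₅(Y) = (Y𝐢u⁻¹ − u𝐢u⁻¹Yu⁻¹, −u⁻¹Yu⁻¹) are tangent to S³×S³ at (u𝐢u⁻¹, u⁻¹) and satisfy g(J df₅(X), df₅(Y)) = 0 at the point (p,q) = (u𝐢u⁻¹, u⁻¹). -/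
open Quaternion
open scoped RealInnerProductSpace

/-- Left multiplication by a unit quaternion preserves the inner product. -/
theorem inner_unit_mul_left {u : ℍ[ℝ]} (hu : ‖u‖ = 1) (x y : ℍ[ℝ]) :
    ⟪u * x, u * y⟫ = ⟪x, y⟫ := by
  have h := Quaternion.normSq_eq_norm_mul_self u
  rw [hu, Quaternion.normSq_def'] at h
  simp only [Quaternion.inner_def, Quaternion.re_mul, Quaternion.imI_mul, Quaternion.imJ_mul,
    Quaternion.imK_mul, Quaternion.re_star, Quaternion.imI_star, Quaternion.imJ_star,
    Quaternion.imK_star]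
  linear_combination (x.re * y.re + x.imI * y.imI + x.imJ * y.imJ + x.imK * y.imK) * h

/-- Right multiplication by a unit quaternion preserves the inner product. -/
theorem inner_mul_unit_right {u : ℍ[ℝ]} (hu : ‖u‖ = 1) (x y : ℍ[ℝ]) :
    ⟪x * u, y * u⟫ = ⟪x, y⟫ := by
  have h := Quaternion.normSq_eq_norm_mul_self u
  rw [hu, Quaternion.normSq_def'] at h
  simp only [Quaternion.inner_def, Quaternion.re_mul, Quaternion.imI_mul, Quaternion.imJ_mul,
    Quaternion.imK_mul, Quaternion.re_star, Quaternion.imI_star, Quaternion.imJ_star,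
    Quaternion.imK_star]
  linear_combination (x.re * y.re + x.imI * y.imI + x.imJ * y.imJ + x.imK * y.imK) * h

/-- In the left trivialization `X = u * a`, the tangent vector `df₅(X)` is
`(u * (a * 𝐢 - 𝐢 * a) * u⁻¹, -a * u⁻¹)`. -/
theorem f5_differential_left_trivialized {u : ℍ[ℝ]} (h0 : u ≠ 0) (a : ℍ[ℝ]) :
    u * a * qI * u⁻¹ - u * qI * u⁻¹ * (u * a) * u⁻¹ = u * (a * qI - qI * a) * u⁻¹ ∧
      -(u⁻¹ * (u * a) * u⁻¹) = -a * u⁻¹ := by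
  constructor
  · simp only [mul_sub, sub_mul, mul_assoc, inv_mul_cancel_left₀ h0]
  · rw [inv_mul_cancel_left₀ h0, neg_mul]

/-- `J` at `(u𝐢u⁻¹, u⁻¹)` in the left trivialization. -/
theorem Jmap_left_trivialized {u : ℍ[ℝ]} (h0 : u ≠ 0) (s t : ℍ[ℝ]) :
    Jmap (u * qI * u⁻¹) u⁻¹ (u * s * u⁻¹, t * u⁻¹) =
      (u * ((Real.sqrt 3)⁻¹ • (2 * (qI * t) - s)) * u⁻¹,
        ((Real.sqrt 3)⁻¹ • (2 * (qI * s) + t)) * u⁻¹) := by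
  simp only [Jmap, mul_inv_rev, inv_inv, qI_inv, two_mul, mul_smul_comm, smul_mul_assoc, mul_sub,
    sub_mul, mul_add, add_mul, mul_neg, neg_mul, neg_add, neg_neg, mul_assoc,
    inv_mul_cancel_left₀ h0]

/-- `g` at `(u𝐢u⁻¹, u⁻¹)` in the left trivialization. -/
theorem gNK_left_trivialized {u : ℍ[ℝ]} (hu : ‖u‖ = 1) (s t s' t' : ℍ[ℝ]) :
    gNK (u * qI * u⁻¹) u⁻¹ (u * s * u⁻¹, t * u⁻¹) (u * s' * u⁻¹, t' * u⁻¹) =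
      (4/3) * (⟪s, s'⟫ + ⟪t, t'⟫) + (2/3) * (⟪qI * s, t'⟫ + ⟪qI * s', t⟫) := by
  have h0 : u ≠ 0 := norm_ne_zero_iff.mp (by rw [hu]; exact one_ne_zero)
  have hu' : ‖u⁻¹‖ = 1 := by rw [norm_inv, hu, inv_one]
  have hp (x : ℍ[ℝ]) : (u * qI * u⁻¹)⁻¹ * (u * x * u⁻¹) = u * -(qI * x) * u⁻¹ := by
    simp only [mul_inv_rev, inv_inv, qI_inv, mul_neg, neg_mul, mul_assoc,
      inv_mul_cancel_left₀ h0]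
  have hq (x : ℍ[ℝ]) : u⁻¹⁻¹ * (x * u⁻¹) = u * x * u⁻¹ := by rw [inv_inv, mul_assoc]
  simp only [gNK, hp, hq, inner_mul_unit_right hu', inner_unit_mul_left hu, inner_neg_left]
  ring

/-- The totally geodesic immersion `f₅ : S³ → S³×S³`, `u ↦ (u𝐢u⁻¹, u⁻¹)`, is Lagrangian:
its differentials `(X𝐢u⁻¹ − u𝐢u⁻¹Xu⁻¹, −u⁻¹Xu⁻¹)` are tangent to `S³×S³` at
`(u𝐢u⁻¹, u⁻¹)` and `g(J df₅(X), df₅(Y)) = 0`. -/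
theorem f5_lagrangian (u X Y : ℍ[ℝ]) (hu : ‖u‖ = 1)
    (hX : ⟪X, u⟫ = 0) (hY : ⟪Y, u⟫ = 0) :
    (⟪X * qI * u⁻¹ - u * qI * u⁻¹ * X * u⁻¹, u * qI * u⁻¹⟫ = 0 ∧
        ⟪-(u⁻¹ * X * u⁻¹), u⁻¹⟫ = 0 ∧
      ⟪Y * qI * u⁻¹ - u * qI * u⁻¹ * Y * u⁻¹, u * qI * u⁻¹⟫ = 0 ∧
        ⟪-(u⁻¹ * Y * u⁻¹), u⁻¹⟫ = 0) ∧
      gNK (u * qI * u⁻¹) u⁻¹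
        (Jmap (u * qI * u⁻¹) u⁻¹
          (X * qI * u⁻¹ - u * qI * u⁻¹ * X * u⁻¹, -(u⁻¹ * X * u⁻¹)))
        (Y * qI * u⁻¹ - u * qI * u⁻¹ * Y * u⁻¹, -(u⁻¹ * Y * u⁻¹)) = 0 := by
  have h0 : u ≠ 0 := norm_ne_zero_iff.mp (by rw [hu]; exact one_ne_zero)
  have hu' : ‖u⁻¹‖ = 1 := by rw [norm_inv, hu, inv_one]
  obtain ⟨a, rfl⟩ : ∃ a, X = u * a := ⟨u⁻¹ * X, (mul_inv_cancel_left₀ h0 X).symm⟩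
  obtain ⟨b, rfl⟩ : ∃ b, Y = u * b := ⟨u⁻¹ * Y, (mul_inv_cancel_left₀ h0 Y).symm⟩
  have re_eq_zero {c : ℍ[ℝ]} (hc : ⟪u * c, u⟫ = 0) : c.re = 0 := by
    have h := inner_unit_mul_left hu c 1
    rw [mul_one, hc] at h
    simpa [Quaternion.inner_def] using h.symm
  have ha := re_eq_zero hX
  have hb := re_eq_zero hY
  have tangent_fst (c : ℍ[ℝ]) : ⟪u * (c * qI - qI * c) * u⁻¹, u * qI * u⁻¹⟫ = 0 := by
    rw [inner_mul_unit_right hu', inner_unit_mul_left hu]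
    simp [Quaternion.inner_def, mul_comm]
  have tangent_snd {c : ℍ[ℝ]} (hc : c.re = 0) : ⟪-c * u⁻¹, u⁻¹⟫ = 0 := by
    have h := inner_mul_unit_right hu' (-c) 1
    rw [one_mul] at h
    rw [h]
    simp [Quaternion.inner_def, hc]
  obtain ⟨hU, hV⟩ := f5_differential_left_trivialized h0 a
  obtain ⟨hU', hV'⟩ := f5_differential_left_trivialized h0 b
  rw [hU, hV, hU', hV']
  refine ⟨⟨tangent_fst a, tangent_snd ha, tangent_fst b, tangent_snd hb⟩, ?_⟩
  rw [Jmap_left_trivialized h0, gNK_left_trivialized hu]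
  simp only [mul_smul_comm, real_inner_smul_left, real_inner_smul_right]
  simp [Quaternion.inner_def, two_mul, ha, hb]
  ring
end

section
/- The immersion f₇ : S³ → S³×S³, u ↦ (u𝐢u⁻¹, u𝐣u⁻¹), where 𝐢, 𝐣 are imaginary quaternion units, is Lagrangian: for every unit quaternion u and all X, Y ∈ ℍ with ⟨X,u⟩ = ⟨Y,u⟩ = 0, the differentials df₇(X) = (X𝐢u⁻¹ − u𝐢u⁻¹Xu⁻¹, X𝐣u⁻¹ − u𝐣u⁻¹Xu⁻¹), df₇(Y) = (Y𝐢u⁻¹ − u𝐢u⁻¹Yu⁻¹, Y𝐣u⁻¹ − u𝐣u⁻¹Yu⁻¹) are tangent to S³×S³ at (u𝐢u⁻¹, u𝐣u⁻¹) and satisfy g(J df₇(X), df₇(Y)) = 0 at the point (p,q) = (u𝐢u⁻¹, u𝐣u⁻¹). -/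
open Quaternion
open scoped RealInnerProductSpace

theorem inner_unit_conj {u : ℍ[ℝ]} (hu : ‖u‖ = 1) (x y : ℍ[ℝ]) :
    ⟪u * x * u⁻¹, u * y * u⁻¹⟫ = ⟪x, y⟫ := by
  have h0 : u ≠ 0 := by
    rintro rfl
    simp at hu
  have hn (z : ℍ[ℝ]) : ‖u * z * u⁻¹‖ = ‖z‖ := by simp [hu]
  rw [real_inner_eq_norm_add_mul_self_sub_norm_mul_self_sub_norm_mul_self_div_two,
    real_inner_eq_norm_add_mul_self_sub_norm_mul_self_sub_norm_mul_self_div_two,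
    ← add_mul, ← mul_add, hn, hn, hn]

theorem mul_of_conj {u : ℍ[ℝ]} (h0 : u ≠ 0) (x y : ℍ[ℝ]) :
    u * x * u⁻¹ * (u * y * u⁻¹) = u * (x * y) * u⁻¹ := by
  simp only [mul_assoc, inv_mul_cancel_left₀ h0]

theorem inv_of_conj {u : ℍ[ℝ]} (x : ℍ[ℝ]) : (u * x * u⁻¹)⁻¹ = u * x⁻¹ * u⁻¹ := by
  simp only [mul_inv_rev, inv_inv, mul_assoc]

theorem Jmap_conj {u : ℍ[ℝ]} (h0 : u ≠ 0) (p q U V : ℍ[ℝ]) :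
    Jmap (u * p * u⁻¹) (u * q * u⁻¹) (u * U * u⁻¹, u * V * u⁻¹) =
      (u * (Jmap p q (U, V)).1 * u⁻¹, u * (Jmap p q (U, V)).2 * u⁻¹) := by
  simp only [Jmap, inv_of_conj, mul_of_conj h0, two_mul, mul_smul_comm, smul_mul_assoc,
    mul_add, add_mul, mul_sub, sub_mul, mul_neg, neg_mul]

theorem gNK_conj {u : ℍ[ℝ]} (hu : ‖u‖ = 1) (h0 : u ≠ 0) (p q U V U' V' : ℍ[ℝ]) :
    gNK (u * p * u⁻¹) (u * q * u⁻¹) (u * U * u⁻¹, u * V * u⁻¹) (u * U' * u⁻¹, u * V' * u⁻¹) =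
      gNK p q (U, V) (U', V') := by
  simp only [gNK, inv_of_conj, mul_of_conj h0, inner_unit_conj hu]

@[simp] theorem qJ_re : qJ.re = 0 := rfl

@[simp] theorem qJ_imI : qJ.imI = 0 := rfl

@[simp] theorem qJ_imJ : qJ.imJ = 1 := rfl

@[simp] theorem qJ_imK : qJ.imK = 0 := rfl

theorem qJ_inv : qJ⁻¹ = -qJ := by
  apply inv_eq_of_mul_eq_one_right
  ext <;> simp

theorem inner_commutator_qI (a : ℍ[ℝ]) : ⟪a * qI - qI * a, qI⟫ = 0 := by
  simp [Quaternion.inner_def]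

theorem inner_commutator_qJ (a : ℍ[ℝ]) : ⟪a * qJ - qJ * a, qJ⟫ = 0 := by
  simp [Quaternion.inner_def]

theorem gNK_Jmap_commutator (a b : ℍ[ℝ]) :
    gNK qI qJ (Jmap qI qJ (a * qI - qI * a, a * qJ - qJ * a))
      (b * qI - qI * b, b * qJ - qJ * b) = 0 := by
  simp only [gNK, Jmap, qI_inv, qJ_inv, mul_smul_comm, inner_smul_left, inner_smul_right,
    two_mul, Quaternion.inner_def]
  simp
  ring

/-- The immersion `f₇ : S³ → S³×S³`, `u ↦ (u𝐢u⁻¹, u𝐣u⁻¹)`, is Lagrangian: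
its differentials `(X𝐢u⁻¹ − u𝐢u⁻¹Xu⁻¹, X𝐣u⁻¹ − u𝐣u⁻¹Xu⁻¹)` are tangent to `S³×S³`
at `(u𝐢u⁻¹, u𝐣u⁻¹)` and `g(J df₇(X), df₇(Y)) = 0`. -/
theorem f7_lagrangian (u X Y : ℍ[ℝ]) (hu : ‖u‖ = 1)
    (hX : ⟪X, u⟫ = 0) (hY : ⟪Y, u⟫ = 0) :
    (⟪X * qI * u⁻¹ - u * qI * u⁻¹ * X * u⁻¹, u * qI * u⁻¹⟫ = 0 ∧
        ⟪X * qJ * u⁻¹ - u * qJ * u⁻¹ * X * u⁻¹, u * qJ * u⁻¹⟫ = 0 ∧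
      ⟪Y * qI * u⁻¹ - u * qI * u⁻¹ * Y * u⁻¹, u * qI * u⁻¹⟫ = 0 ∧
        ⟪Y * qJ * u⁻¹ - u * qJ * u⁻¹ * Y * u⁻¹, u * qJ * u⁻¹⟫ = 0) ∧
      gNK (u * qI * u⁻¹) (u * qJ * u⁻¹)
        (Jmap (u * qI * u⁻¹) (u * qJ * u⁻¹)
          (X * qI * u⁻¹ - u * qI * u⁻¹ * X * u⁻¹, X * qJ * u⁻¹ - u * qJ * u⁻¹ * X * u⁻¹))
        (Y * qI * u⁻¹ - u * qI * u⁻¹ * Y * u⁻¹, Y * qJ * u⁻¹ - u * qJ * u⁻¹ * Y * u⁻¹) = 0 := by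
  have h0 : u ≠ 0 := by
    rintro rfl
    simp at hu
  obtain ⟨a, rfl⟩ : ∃ a, X = u * a := ⟨u⁻¹ * X, (mul_inv_cancel_left₀ h0 X).symm⟩
  obtain ⟨b, rfl⟩ : ∃ b, Y = u * b := ⟨u⁻¹ * Y, (mul_inv_cancel_left₀ h0 Y).symm⟩
  have key (c e : ℍ[ℝ]) :
      u * c * e * u⁻¹ - u * e * u⁻¹ * (u * c) * u⁻¹ = u * (c * e - e * c) * u⁻¹ := by
    simp only [mul_sub, sub_mul, mul_assoc, inv_mul_cancel_left₀ h0]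
  simp only [key, inner_unit_conj hu, Jmap_conj h0, gNK_conj hu h0]
  exact ⟨⟨inner_commutator_qI a, inner_commutator_qJ a, inner_commutator_qI b,
    inner_commutator_qJ b⟩, gNK_Jmap_commutator a b⟩
end
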